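/- arXiv:1512.04297 — 3 statements merged into one kernel-verified Lean document; each statement's English description precedes it below -/
import Mathlib

section
/- Let q be a prime power and let 1 ≤ k ≤ n be integers with n ≡ 1 (mod k) and n > k. Then the maximum cardinality of a partial k-spread in 𝔽_q^n equals (q^n − q^{k+1} + q^k − 1)/(q^k − 1); that is, every partial k-spread in 𝔽_q^n has at most this many members, and a partial k-spread of exactly this size exists. -/
/-- A partial `k`-spread in `𝔽_q^n`: a set of `k`-dimensional subspaces
any two distinct members of which intersect trivially. -/
def IsPartialSpread (F : Type) [Field F] {n : ℕ} (k : ℕ)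
    (S : Finset (Submodule F (Fin n → F))) : Prop :=
  (∀ U ∈ S, Module.finrank F U = k) ∧
  ∀ U ∈ S, ∀ V ∈ S, U ≠ V → U ⊓ V = ⊥

open Module in
/-- A vector space carries an indexed partial spread with `N` members. -/
def HasSpread (F : Type) [Field F] (V : Type) [AddCommGroup V] [Module F V] (k N : ℕ) : Prop :=
  ∃ (ι : Type) (_ : Fintype ι) (g : ι → Submodule F V), Fintype.card ι = N ∧
    (∀ i, finrank F (g i) = k) ∧ ∀ i j, i ≠ j → g i ⊓ g j = ⊥

open Module

theorem HasSpread.of_equiv {F : Type} [Field F] {V W : Type} [AddCommGroup V] [Module F V]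
    [AddCommGroup W] [Module F W] {k N : ℕ} (e : V ≃ₗ[F] W) (h : HasSpread F V k N) :
    HasSpread F W k N := by
  obtain ⟨ι, _, g, hc, hd, hp⟩ := h
  refine ⟨ι, inferInstance, fun i => (g i).map (e : V →ₗ[F] W), hc, fun i => ?_, fun i j hij => ?_⟩
  · rw [LinearEquiv.finrank_map_eq, hd]
  · rw [← Submodule.map_inf _ e.injective, hp i j hij, Submodule.map_bot]

theorem HasSpread.step {F : Type} [Field F] [Fintype F] {k N d : ℕ} (hd : k < d)
    (h : ∀ (V : Type) [AddCommGroup V] [Module F V] [FiniteDimensional F V],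
      finrank F V = d → HasSpread F V k N)
    (V : Type) [AddCommGroup V] [Module F V] [FiniteDimensional F V]
    (hV : finrank F V = d + k) : HasSpread F V k (Fintype.card F ^ d + N) := by
  classical
  obtain ⟨p, hp⟩ := CharP.exists F
  have : Fact p.Prime := ⟨CharP.char_is_prime F p⟩
  have : NeZero d := ⟨by omega⟩
  let K := FiniteField.Extension F p d
  have hK : finrank F K = d := FiniteField.finrank_extension F p d
  have : Fintype K := Fintype.ofFinite K
  have hKc : Fintype.card K = Fintype.card F ^ d := by
    rw [Module.card_eq_pow_finrank (K := F), hK]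
  obtain ⟨φ, hφ⟩ : ∃ φ : (Fin k → F) →ₗ[F] K, Function.Injective φ := by
    apply Module.Free.exists_linearMap_injective_of_rank_lt
    rw [← finrank_eq_rank, ← finrank_eq_rank, hK]
    simpa using hd
  obtain ⟨ι, _, g, hc, hg, hpw⟩ := h K hK
  have e : ((Fin k → F) × K) ≃ₗ[F] V := LinearEquiv.ofFinrankEq _ _ (by
    rw [finrank_prod, hK, hV]; simp [add_comm])
  refine HasSpread.of_equiv e ⟨K ⊕ ι, inferInstance,
    Sum.elim (fun a => LinearMap.range (LinearMap.prod LinearMap.id (LinearMap.mulLeft F a ∘ₗ φ)))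
      (fun i => (g i).map (LinearMap.inr F (Fin k → F) K)), ?_, ?_, ?_⟩
  · rw [Fintype.card_sum, hKc, hc]
  · rintro (a | i)
    · refine (LinearMap.finrank_range_of_inj
        (f := LinearMap.prod LinearMap.id (LinearMap.mulLeft F a ∘ₗ φ)) ?_).trans ?_
      rotate_left
      · simp
      · intro x y hxy
        simpa using congrArg Prod.fst hxy
    · exact (Submodule.equivMapOfInjective (LinearMap.inr F (Fin k → F) K)
        LinearMap.inr_injective (g i)).finrank_eq.symm.trans (hg i)
  · have mixed : ∀ (a : K) (i : ι),
        LinearMap.range (LinearMap.prod LinearMap.id (LinearMap.mulLeft F a ∘ₗ φ)) ⊓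
          (g i).map (LinearMap.inr F (Fin k → F) K) = ⊥ := by
      intro a i
      rw [eq_bot_iff]
      rintro _ ⟨⟨x, rfl⟩, ⟨y, hy, hxy⟩⟩
      have h1 : (0 : Fin k → F) = x := by simpa using congrArg Prod.fst hxy
      subst h1
      simp
    rintro (a | i) (b | j) hij
    · simp only [Sum.elim_inl]
      have hab : a ≠ b := fun h => hij (by rw [h])
      rw [eq_bot_iff]
      rintro _ ⟨⟨x, rfl⟩, ⟨y, hxy⟩⟩
      have h1 : y = x := by simpa using congrArg Prod.fst hxy
      subst h1
      have h2 : b * φ y = a * φ y := by simpa using congrArg Prod.snd hxy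
      have h3 : φ y = 0 := by
        by_contra hne
        exact hab (mul_right_cancel₀ hne h2).symm
      have h4 : y = 0 := hφ (by rw [h3, map_zero])
      subst h4
      simp
    · exact mixed a j
    · rw [inf_comm]; exact mixed b i
    · simp only [Sum.elim_inr]
      rw [← Submodule.map_inf _ LinearMap.inr_injective,
        hpw i j (fun h => hij (by rw [h])), Submodule.map_bot]

theorem hasSpread_all {F : Type} [Field F] [Fintype F] {k : ℕ} (m : ℕ) :
    ∀ (V : Type) [AddCommGroup V] [Module F V] [FiniteDimensional F V],
      finrank F V = (m + 1) * k + 1 →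
      HasSpread F V k (1 + Fintype.card F ^ (k + 1) *
        ∑ i ∈ Finset.range m, (Fintype.card F ^ k) ^ i) := by
  induction m with
  | zero =>
    intro V _ _ _ hV
    obtain ⟨φ, hφ⟩ : ∃ φ : (Fin k → F) →ₗ[F] V, Function.Injective φ := by
      apply Module.Free.exists_linearMap_injective_of_rank_lt
      rw [← finrank_eq_rank, ← finrank_eq_rank, hV]
      simp only [finrank_fin_fun]
      exact_mod_cast (by omega)
    refine ⟨Unit, inferInstance, fun _ => LinearMap.range φ, by simp, fun _ => ?_, ?_⟩
    · rw [LinearMap.finrank_range_of_inj hφ]; simp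
    · intro i j hij; exact absurd rfl hij
  | succ m ih =>
    intro V _ _ _ hV
    have := HasSpread.step (d := (m + 1) * k + 1) (by nlinarith) ih V (by rw [hV]; ring)
    convert this using 1
    rw [Finset.sum_range_succ]
    ring

/-- Packing inequality inside a subspace `H`. -/
theorem packing {F : Type} [Field F] [Fintype F] {V : Type} [AddCommGroup V] [Module F V]
    [FiniteDimensional F V] (S : Finset (Submodule F V))
    (hS : ∀ U ∈ S, ∀ W ∈ S, U ≠ W → U ⊓ W = ⊥) (H : Submodule F V) :
    ∑ U ∈ S, (Fintype.card F ^ finrank F (U ⊓ H : Submodule F V) - 1)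
      ≤ Fintype.card F ^ finrank F H - 1 := by
  classical
  have : Finite V := Module.finite_of_finite F
  have : Fintype V := Fintype.ofFinite V
  have key : ∀ W : Submodule F V, (Finset.univ.filter (fun x => x ∈ W ∧ x ≠ 0)).card
      = Fintype.card F ^ finrank F W - 1 := by
    intro W
    rw [← Module.card_eq_pow_finrank (K := F) (V := W)]
    have : (Finset.univ.filter (fun x => x ∈ W ∧ x ≠ 0))
        = (Finset.univ.filter (fun x => x ∈ W)).erase 0 := by
      ext x; simp [and_comm]
    rw [this, Finset.card_erase_of_mem (by simp), Fintype.card_subtype]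
  simp_rw [← key]
  rw [← Finset.card_biUnion]
  · apply Finset.card_le_card
    intro x
    simp only [Finset.mem_biUnion, Finset.mem_filter, Finset.mem_univ, true_and,
      Submodule.mem_inf]
    rintro ⟨U, _, ⟨_, h⟩, h0⟩
    exact ⟨h, h0⟩
  · intro U hU W hW hUW
    rw [Function.onFun, Finset.disjoint_left]
    intro x hx hx'
    simp only [Finset.mem_filter, Finset.mem_univ, true_and, Submodule.mem_inf] at hx hx'
    have : x ∈ U ⊓ W := ⟨hx.1.1, hx'.1.1⟩
    rw [hS U hU W hW hUW] at this
    exact hx.2 (by simpa using this)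

theorem finrank_inf_ker_ge {F : Type} [Field F] {V : Type} [AddCommGroup V] [Module F V]
    [FiniteDimensional F V] (U : Submodule F V) (f : Dual F V) :
    finrank F U ≤ finrank F (U ⊓ LinearMap.ker f : Submodule F V) + 1 := by
  have h1 := Submodule.finrank_sup_add_finrank_inf_eq U (LinearMap.ker f)
  have h2 := f.finrank_range_add_finrank_ker
  have h3 : finrank F (LinearMap.range f) ≤ 1 := by
    simpa using Submodule.finrank_le (LinearMap.range f)
  have h4 := Submodule.finrank_le (U ⊔ LinearMap.ker f)
  omega

theorem finrank_ker_of_ne {F : Type} [Field F] {V : Type} [AddCommGroup V] [Module F V]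
    [FiniteDimensional F V] (f : Dual F V) (hf : f ≠ 0) :
    finrank F (LinearMap.ker f) + 1 = finrank F V := by
  have h2 := f.finrank_range_add_finrank_ker
  have h3 : LinearMap.range f = ⊤ := LinearMap.range_eq_top.2 (LinearMap.surjective hf)
  rw [h3, finrank_top, finrank_self] at h2
  omega

open Classical in
theorem hyperplane_count {F : Type} [Field F] [Fintype F] {V : Type} [AddCommGroup V] [Module F V]
    [FiniteDimensional F V] {n k : ℕ} (hn : finrank F V = n + 1) (S : Finset (Submodule F V))
    (hk : ∀ U ∈ S, finrank F U = k + 1)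
    (hS : ∀ U ∈ S, ∀ W ∈ S, U ≠ W → U ⊓ W = ⊥) (f : Dual F V) (hf : f ≠ 0) :
    ((S.filter (fun U => U ≤ LinearMap.ker f)).card : ℤ) *
        ((Fintype.card F : ℤ) ^ (k + 1) - (Fintype.card F : ℤ) ^ k)
      + S.card * ((Fintype.card F : ℤ) ^ k - 1) ≤ (Fintype.card F : ℤ) ^ n - 1 := by
  have hp := packing S hS (LinearMap.ker f)
  have hq : 1 ≤ Fintype.card F := Fintype.card_pos
  have hker : finrank F (LinearMap.ker f) = n := by
    have := finrank_ker_of_ne f hf; omega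
  rw [hker] at hp
  zify at hp
  rw [Nat.cast_sub (Nat.one_le_pow _ _ hq)] at hp
  push_cast at hp
  refine le_trans ?_ hp
  rw [Finset.card_filter, Finset.card_eq_sum_ones]
  push_cast
  rw [Finset.sum_mul, Finset.sum_mul, ← Finset.sum_add_distrib]
  apply Finset.sum_le_sum
  intro U hU
  rw [Nat.cast_sub (Nat.one_le_pow _ _ hq)]
  push_cast
  split_ifs with h
  · rw [inf_eq_left.2 h, hk U hU]; linarith
  · have h1 := finrank_inf_ker_ge U f
    rw [hk U hU] at h1
    have : (Fintype.card F : ℤ) ^ k ≤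
      (Fintype.card F : ℤ) ^ finrank F (U ⊓ LinearMap.ker f : Submodule F V) :=
      pow_le_pow_right₀ (by exact_mod_cast hq) (by omega)
    linarith

open Classical in
theorem double_count {F : Type} [Field F] [Fintype F] {V : Type} [AddCommGroup V] [Module F V]
    [FiniteDimensional F V] {r k A : ℕ} (hn : finrank F V = r + k) (S : Finset (Submodule F V))
    (hk : ∀ U ∈ S, finrank F U = k)
    (hA : ∀ f : Dual F V, f ≠ 0 → (S.filter (fun U => U ≤ LinearMap.ker f)).card ≤ A) :
    S.card * (Fintype.card F ^ r - 1) ≤ (Fintype.card F ^ (r + k) - 1) * A := by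
  have : Finite (Dual F V) := Module.finite_of_finite F
  have : Fintype (Dual F V) := Fintype.ofFinite _
  have e1 : ∀ U ∈ S, ((Finset.univ.erase (0 : Dual F V)).filter
      (fun f => U ≤ LinearMap.ker f)).card = Fintype.card F ^ r - 1 := by
    intro U hU
    have h1 : finrank F U.dualAnnihilator = r := by
      have := Subspace.finrank_add_finrank_dualAnnihilator_eq U
      rw [hk U hU] at this; omega
    rw [← h1, ← Module.card_eq_pow_finrank (K := F) (V := U.dualAnnihilator)]
    have : ((Finset.univ.erase (0 : Dual F V)).filter (fun f => U ≤ LinearMap.ker f))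
        = (Finset.univ.filter (fun f => f ∈ U.dualAnnihilator)).erase 0 := by
      ext f
      simp only [Finset.mem_filter, Finset.mem_erase, Finset.mem_univ, Submodule.mem_dualAnnihilator,
        true_and, and_true]
      rfl
    rw [this, Finset.card_erase_of_mem (by simp), Fintype.card_subtype]
  have e2 : (Finset.univ.erase (0 : Dual F V)).card = Fintype.card F ^ (r + k) - 1 := by
    rw [Finset.card_erase_of_mem (Finset.mem_univ _), Finset.card_univ,
      Module.card_eq_pow_finrank (K := F), Subspace.dual_finrank_eq, hn]
  rw [← e2, ← smul_eq_mul, ← smul_eq_mul, ← Finset.sum_const, ← Finset.sum_congr rfl e1]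
  simp_rw [Finset.card_filter]
  rw [Finset.sum_comm, ← Finset.sum_const]
  apply Finset.sum_le_sum
  intro f hf
  rw [← Finset.card_filter]
  exact hA f (Finset.ne_of_mem_erase hf)

theorem spread_upper {F : Type} [Field F] [Fintype F] {V : Type} [AddCommGroup V] [Module F V]
    [FiniteDimensional F V] {k m : ℕ} (hk2 : 1 ≤ k)
    (hn : finrank F V = (m + 1) * (k + 1) + 1) (S : Finset (Submodule F V))
    (hk : ∀ U ∈ S, finrank F U = k + 1)
    (hS : ∀ U ∈ S, ∀ W ∈ S, U ≠ W → U ⊓ W = ⊥) :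
    S.card ≤ 1 + Fintype.card F ^ (k + 2) *
        ∑ i ∈ Finset.range m, (Fintype.card F ^ (k + 1)) ^ i := by
  classical
  by_contra! hlt
  have hq1 : 1 < Fintype.card F := Fintype.one_lt_card
  set q := Fintype.card F with hq
  set T := ∑ i ∈ Finset.range m, (q ^ (k + 1)) ^ i with hT
  have hTe : (T : ℤ) * ((q : ℤ) ^ (k + 1) - 1) = ((q : ℤ) ^ (k + 1)) ^ m - 1 := by
    rw [hT]; push_cast; exact geom_sum_mul _ _
  have hqz : (2 : ℤ) ≤ q := by exact_mod_cast hq1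
  have hP : (2 : ℤ) ≤ (q : ℤ) ^ k :=
    le_trans hqz (le_self_pow₀ (by linarith) (by omega))
  have hN : (2 : ℤ) + (q : ℤ) ^ (k + 2) * T ≤ S.card := by exact_mod_cast (by omega)
  have hT0 : (0 : ℤ) ≤ T := by positivity
  have hA : ∀ f : Dual F V, f ≠ 0 →
      (S.filter (fun U => U ≤ LinearMap.ker f)).card ≤ q * T := by
    intro f hf
    have h := hyperplane_count hn S hk hS f hf
    rw [← hq] at h
    by_contra! hc
    have hc' : (q : ℤ) * T + 1 ≤ (S.filter (fun U => U ≤ LinearMap.ker f)).card := by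
      exact_mod_cast hc
    have e : (q : ℤ) ^ ((m + 1) * (k + 1)) = (q : ℤ) ^ (k + 1) * ((q : ℤ) ^ (k + 1)) ^ m := by
      rw [← pow_mul]; ring
    have e' : ((q : ℤ) ^ (k + 1)) ^ m = T * ((q : ℤ) ^ (k + 1) - 1) + 1 := by linarith
    rw [e, e'] at h
    simp only [pow_succ] at h hN
    generalize (q : ℤ) ^ k = P at *
    generalize (T : ℤ) = t at *
    generalize (q : ℤ) = x at *
    have i1 := mul_le_mul_of_nonneg_right hc' (show 0 ≤ P * x - P by nlinarith)
    have i2 := mul_le_mul_of_nonneg_right hN (show 0 ≤ P - 1 by linarith)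
    nlinarith
  have hD := double_count (r := m * (k + 1) + 1) (k := k + 1) (by rw [hn]; ring) S hk hA
  rw [← hq] at hD
  zify at hD
  rw [Nat.cast_sub (Nat.one_le_pow _ _ (by omega)), Nat.cast_sub (Nat.one_le_pow _ _ (by omega))]
    at hD
  push_cast at hD
  have e1 : (q : ℤ) ^ (m * (k + 1) + 1) = q * ((q : ℤ) ^ (k + 1)) ^ m := by
    rw [← pow_mul]; ring
  have e2 : (q : ℤ) ^ (m * (k + 1) + 1 + (k + 1)) =
      q * (q : ℤ) ^ (k + 1) * ((q : ℤ) ^ (k + 1)) ^ m := by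
    rw [← pow_mul]; ring
  have e' : ((q : ℤ) ^ (k + 1)) ^ m = T * ((q : ℤ) ^ (k + 1) - 1) + 1 := by linarith
  rw [e1, e2, e'] at hD
  have e3 : (q : ℤ) ^ (k + 2) = q * (q : ℤ) ^ (k + 1) := by ring
  rw [e3] at hN
  have hQ : (2 : ℤ) ≤ (q : ℤ) ^ (k + 1) := by rw [pow_succ]; nlinarith
  generalize (q : ℤ) ^ (k + 1) = Q at *
  generalize (T : ℤ) = t at *
  generalize (q : ℤ) = x at *
  have i0 : 0 ≤ t * (Q - 1) := mul_nonneg hT0 (by linarith)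
  have i1 := mul_le_mul_of_nonneg_right hN (show 0 ≤ x * (t * (Q - 1) + 1) - 1 by nlinarith)
  have i3 : 0 ≤ x * (t * (Q - 1)) := mul_nonneg (by linarith) i0
  nlinarith

/-- For `n ≡ 1 (mod k)` and `n > k`, the maximum size of a partial `k`-spread
in `𝔽_q^n` is `(q^n − q^(k+1) + q^k − 1)/(q^k − 1)`. -/
theorem partial_spread_max_mod_one (F : Type) [Field F] [Fintype F] (q n k : ℕ)
    (hq : Fintype.card F = q) (hk : 1 ≤ k) (hkn : k ≤ n)
    (hmod : n % k = 1) (hnk : k < n) :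
    IsGreatest {c : ℕ | ∃ S : Finset (Submodule F (Fin n → F)),
        IsPartialSpread F k S ∧ S.card = c}
      ((q ^ n - q ^ (k + 1) + q ^ k - 1) / (q ^ k - 1)) := by
  classical
  have hq1 : 1 < q := hq ▸ Fintype.one_lt_card
  obtain ⟨k, rfl⟩ : ∃ j, k = j + 1 := ⟨k - 1, by omega⟩
  have hk1 : 1 ≤ k := by
    rcases Nat.eq_zero_or_pos k with rfl | h
    · omega
    · exact h
  obtain ⟨m, rfl⟩ : ∃ m, n = (m + 1) * (k + 1) + 1 := by
    have h1 := Nat.div_add_mod n (k + 1)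
    have h2 : 1 ≤ n / (k + 1) := (Nat.one_le_div_iff (by omega)).2 hkn
    refine ⟨n / (k + 1) - 1, ?_⟩
    rw [Nat.sub_add_cancel h2, mul_comm]; omega
  have hval : (q ^ ((m + 1) * (k + 1) + 1) - q ^ (k + 1 + 1) + q ^ (k + 1) - 1) / (q ^ (k + 1) - 1)
      = 1 + q ^ (k + 2) * ∑ i ∈ Finset.range m, (q ^ (k + 1)) ^ i := by
    have hQ : 1 < q ^ (k + 1) := Nat.one_lt_pow (by omega) hq1
    have hle : q ^ (k + 1 + 1) ≤ q ^ ((m + 1) * (k + 1) + 1) :=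
      Nat.pow_le_pow_right (by omega) (by nlinarith)
    apply Nat.div_eq_of_eq_mul_left (by omega)
    zify [hle, hQ.le, (show 1 ≤ q ^ ((m + 1) * (k + 1) + 1) - q ^ (k + 1 + 1) + q ^ (k + 1) by omega)]
    have hg := geom_sum_mul ((q : ℤ) ^ (k + 1)) m
    have e2 : (q : ℤ) ^ ((m + 1) * (k + 1) + 1) =
        q ^ (k + 2) * ((q : ℤ) ^ (k + 1)) ^ m := by
      rw [← pow_mul]; ring
    rw [e2]
    linear_combination (-(q : ℤ) ^ (k + 2)) * hg
  rw [hval]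
  constructor
  · obtain ⟨ι, _, g, hc, hd, hp⟩ := hasSpread_all (F := F) (k := k + 1) m
      (Fin ((m + 1) * (k + 1) + 1) → F) (by simp)
    have hinj : Function.Injective g := by
      intro i j hij
      by_contra hne
      have h1 := hp i j hne
      rw [hij, inf_idem] at h1
      have h2 := hd j
      rw [h1, finrank_bot] at h2
      omega
    refine ⟨Finset.univ.image g, ⟨?_, ?_⟩, ?_⟩
    · intro U hU
      obtain ⟨i, _, rfl⟩ := Finset.mem_image.1 hU
      exact hd i
    · intro U hU W hW hne
      obtain ⟨i, _, rfl⟩ := Finset.mem_image.1 hU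
      obtain ⟨j, _, rfl⟩ := Finset.mem_image.1 hW
      exact hp i j (fun h => hne (by rw [h]))
    · rw [Finset.card_image_of_injective _ hinj, Finset.card_univ, hc, hq]
  · rintro c ⟨S, ⟨hS1, hS2⟩, rfl⟩
    have := spread_upper (m := m) hk1 (by simp) S hS1 hS2
    rwa [hq] at this
end

section
/- Let q be a prime power, and let k, t, r be integers with t ≥ 1 and 0 < r < k, and set n = k(t+1) + r. Let θ be the real number satisfying 2θ = √(1 + 4q^k(q^k − q^r)) − (2q^k − 2q^r + 1). Then every partial k-spread in 𝔽_q^n has cardinality at most q^r · (q^{k(t+1)} − 1)/(q^k − 1) − ⌊θ⌋ − 1. -/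
open Module in
lemma psb_card_ann (F : Type) [Field F] [Fintype F] {n : ℕ} [Fintype (Dual F (Fin n → F))]
    (U : Submodule F (Fin n → F)) [DecidablePred (· ∈ U.dualAnnihilator)] (k m : ℕ)
    (h : finrank F U = k) (hm : k + m = n) :
    (∑ φ : Dual F (Fin n → F), if φ ∈ U.dualAnnihilator then (1:ℤ) else 0)
      = (Fintype.card F : ℤ) ^ m := by
  have h1 := Subspace.finrank_add_finrank_dualAnnihilator_eq U
  rw [h, finrank_fin_fun] at h1
  have h2 : finrank F U.dualAnnihilator = m := by omega
  have h3 := Module.card_eq_pow_finrank (K := F) (V := U.dualAnnihilator)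
  rw [h2] at h3
  rw [Finset.sum_boole]
  rw [← Fintype.card_subtype]
  have : Fintype.card {x // x ∈ U.dualAnnihilator} = Fintype.card F ^ m := by
    rw [← h3]
  exact_mod_cast this

open Module in
lemma psb_count (F : Type) [Field F] [Fintype F] {n : ℕ} (k l : ℕ) (hn : n = k + k + l)
    (S : Finset (Submodule F (Fin n → F))) (hS : IsPartialSpread F k S) (M : ℤ) :
    0 ≤ (S.card : ℤ) * (Fintype.card F : ℤ) ^ (k + l)
      + (S.card : ℤ) * (S.card - 1) * (Fintype.card F : ℤ) ^ l
      - (2 * M + 1) * (S.card * (Fintype.card F : ℤ) ^ (k + l))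
      + M * (M + 1) * (Fintype.card F : ℤ) ^ n
      - (S.card - M) * (S.card - M - 1) := by
  classical
  have : Finite (Dual F (Fin n → F)) := Module.finite_of_finite F
  let _ := Fintype.ofFinite (Dual F (Fin n → F))
  set b : Dual F (Fin n → F) → ℤ := fun φ => ∑ U ∈ S, if φ ∈ U.dualAnnihilator then (1:ℤ) else 0
    with hb
  have hcard : (Fintype.card (Dual F (Fin n → F)) : ℤ) = (Fintype.card F : ℤ) ^ n := by
    have := Module.card_eq_pow_finrank (K := F) (V := Dual F (Fin n → F))
    rw [Subspace.dual_finrank_eq, finrank_fin_fun] at this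
    exact_mod_cast this
  have hs1 : ∑ φ, b φ = S.card * (Fintype.card F : ℤ) ^ (k + l) := by
    rw [hb, Finset.sum_comm]
    rw [Finset.sum_congr rfl (fun U hU => psb_card_ann F U k (k + l) (hS.1 U hU) (by omega))]
    simp
  have hpair : ∀ U ∈ S, ∀ W ∈ S, (∑ φ : Dual F (Fin n → F),
      (if φ ∈ U.dualAnnihilator then (1:ℤ) else 0) * (if φ ∈ W.dualAnnihilator then (1:ℤ) else 0))
      = (Fintype.card F : ℤ) ^ l +
        if U = W then (Fintype.card F : ℤ) ^ (k + l) - (Fintype.card F : ℤ) ^ l else 0 := by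
    intro U hU W hW
    by_cases h : U = W
    · subst h
      simp only [if_true]
      rw [add_sub_cancel, ← psb_card_ann F U k (k + l) (hS.1 U hU) (by omega)]
      refine Finset.sum_congr rfl fun φ _ => ?_
      split_ifs <;> simp
    · simp only [h, if_false, add_zero]
      have hd := Submodule.finrank_sup_add_finrank_inf_eq U W
      rw [hS.2 U hU W hW h, finrank_bot, hS.1 U hU, hS.1 W hW, add_zero] at hd
      rw [← psb_card_ann F (U ⊔ W) (k + k) l hd (by omega)]
      refine Finset.sum_congr rfl fun φ _ => ?_
      rw [Submodule.dualAnnihilator_sup_eq]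
      simp only [Submodule.mem_inf]
      split_ifs <;> simp_all
  have hs2 : ∑ φ, b φ * b φ = S.card * (Fintype.card F : ℤ) ^ (k + l)
      + (S.card : ℤ) * (S.card - 1) * (Fintype.card F : ℤ) ^ l := by
    have : ∑ φ, b φ * b φ = ∑ U ∈ S, ∑ W ∈ S, ∑ φ : Dual F (Fin n → F),
      (if φ ∈ U.dualAnnihilator then (1:ℤ) else 0) *
        (if φ ∈ W.dualAnnihilator then (1:ℤ) else 0) := by
      simp only [hb, Finset.sum_mul_sum]
      rw [Finset.sum_comm]
      refine Finset.sum_congr rfl fun U _ => ?_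
      rw [Finset.sum_comm]
    rw [this, Finset.sum_congr rfl (fun U hU => Finset.sum_congr rfl (hpair U hU))]
    simp only [Finset.sum_add_distrib, Finset.sum_ite_eq, Finset.sum_const, nsmul_eq_mul]
    rw [Finset.sum_congr rfl (fun U hU => if_pos hU)]
    simp only [Finset.sum_const, nsmul_eq_mul]
    ring
  have hb0 : b 0 = S.card := by simp [hb]
  have hnn : ∀ z : ℤ, 0 ≤ z * (z - 1) := by
    intro z
    rcases le_or_gt z 0 with h | h <;> nlinarith
  have htot : (b 0 - M) * (b 0 - M - 1) ≤ ∑ φ, (b φ - M) * (b φ - M - 1) :=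
    Finset.single_le_sum (f := fun φ => (b φ - M) * (b φ - M - 1))
      (fun φ _ => hnn _) (Finset.mem_univ 0)
  have hexp : ∑ φ, (b φ - M) * (b φ - M - 1) = ∑ φ, b φ * b φ - (2 * M + 1) * ∑ φ, b φ
      + M * (M + 1) * (Fintype.card (Dual F (Fin n → F)) : ℤ) := by
    have : ∀ φ, (b φ - M) * (b φ - M - 1) = b φ * b φ - (2 * M + 1) * b φ + M * (M + 1) := by
      intro φ; ring
    simp only [this, Finset.sum_add_distrib, Finset.sum_sub_distrib, ← Finset.mul_sum]
    simp
    ring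
  rw [hexp, hs1, hs2, hcard, hb0] at htot
  linarith

open Module in
lemma psb_disj (F : Type) [Field F] [Fintype F] {n : ℕ} (k : ℕ)
    (S : Finset (Submodule F (Fin n → F))) (hS : IsPartialSpread F k S) :
    (S.card : ℤ) * ((Fintype.card F : ℤ) ^ k - 1) ≤ (Fintype.card F : ℤ) ^ n - 1 := by
  classical
  have hU : ∀ U ∈ S, ((Finset.univ.filter (· ∈ U)).erase (0 : Fin n → F)).card
      = Fintype.card F ^ k - 1 := by
    intro U hU
    rw [Finset.card_erase_of_mem (by simp), ← Fintype.card_subtype]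
    have h3 := Module.card_eq_pow_finrank (K := F) (V := U)
    rw [hS.1 U hU] at h3
    rw [← h3]
  have hle : (S.biUnion fun U => (Finset.univ.filter (· ∈ U)).erase (0 : Fin n → F)).card
      ≤ (Finset.univ.erase (0 : Fin n → F)).card := by
    apply Finset.card_le_card
    intro v
    simp
    tauto
  rw [Finset.card_biUnion, Finset.sum_congr rfl hU] at hle
  · rw [Finset.card_erase_of_mem (by simp)] at hle
    simp at hle
    have h1 : 1 ≤ Fintype.card F ^ k := Nat.one_le_pow _ _ Fintype.card_pos
    have h2 : 1 ≤ Fintype.card F ^ n := Nat.one_le_pow _ _ Fintype.card_pos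
    zify [h1, h2] at hle
    exact hle
  · intro U hU W hW h
    refine Finset.disjoint_left.mpr ?_
    intro v hv hw
    simp at hv hw
    have : v ∈ U ⊓ W := ⟨hv.2, hw.2⟩
    rw [hS.2 U hU W hW h] at this
    exact hv.1 (by simpa using this)

/-- Upper bound of Corollary 8 in [nets_and_spreads]: for `n = k(t+1) + r` with
`0 < r < k`, every partial `k`-spread in `𝔽_q^n` has cardinality at most
`q^r (q^{k(t+1)} − 1)/(q^k − 1) − ⌊θ⌋ − 1`, where
`2θ = √(1 + 4q^k(q^k − q^r)) − (2q^k − 2q^r + 1)`. -/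
theorem partial_spread_theta_bound (F : Type) [Field F] [Fintype F]
    (q k t r : ℕ) (hq : Fintype.card F = q)
    (ht : 1 ≤ t) (hr : 0 < r) (hrk : r < k)
    (θ : ℝ)
    (hθ : 2 * θ = Real.sqrt (1 + 4 * (q : ℝ) ^ k * ((q : ℝ) ^ k - (q : ℝ) ^ r))
        - (2 * (q : ℝ) ^ k - 2 * (q : ℝ) ^ r + 1))
    (S : Finset (Submodule F (Fin (k * (t + 1) + r) → F)))
    (hS : IsPartialSpread F k S) :
    (S.card : ℝ) ≤
      (q : ℝ) ^ r * ((q : ℝ) ^ (k * (t + 1)) - 1) / ((q : ℝ) ^ k - 1)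
        - (⌊θ⌋ : ℝ) - 1 := by
  obtain ⟨u, rfl⟩ : ∃ u, t = u + 1 := ⟨t - 1, by omega⟩
  have hq2 : 2 ≤ q := hq ▸ Fintype.one_lt_card
  have hcnt := fun M => psb_count F k (k * u + r) (by ring) S hS M
  have hdis := psb_disj F k S hS
  rw [hq] at hcnt hdis
  obtain ⟨M, hM⟩ : ∃ M : ℤ, ((q:ℤ) ^ k - 1) * M = (q:ℤ) ^ r * (q:ℤ) ^ (k * u) * (q:ℤ) ^ k - (q:ℤ) ^ r := by
    obtain ⟨c, hc⟩ := sub_one_dvd_pow_sub_one ((q:ℤ)^k) (u + 1)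
    refine ⟨(q:ℤ) ^ r * c, ?_⟩
    have : ((q:ℤ) ^ k) ^ (u + 1) = (q:ℤ) ^ (k * u) * (q:ℤ) ^ k := by
      rw [pow_succ, pow_mul]
    rw [this] at hc
    linear_combination (-(q:ℤ)^r) * hc
  have hcnt := hcnt M
  have hxy : (q:ℤ) ^ r < (q:ℤ) ^ k := pow_lt_pow_right₀ (by exact_mod_cast hq2) hrk
  have hy : 1 < (q:ℤ) ^ r := one_lt_pow₀ (by exact_mod_cast hq2) (by omega)
  have hR : 0 < (q:ℤ) ^ (k * u) := pow_pos (by omega) _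
  have e1 : (q:ℤ) ^ (k * (u + 1 + 1) + r) = (q:ℤ) ^ r * (q:ℤ) ^ (k * u) * (q:ℤ) ^ k * (q:ℤ) ^ k := by ring
  have e2 : (q:ℤ) ^ (k + (k * u + r)) = (q:ℤ) ^ r * (q:ℤ) ^ (k * u) * (q:ℤ) ^ k := by ring
  have e3 : (q:ℤ) ^ (k * u + r) = (q:ℤ) ^ r * (q:ℤ) ^ (k * u) := by ring
  have e4 : (q:ℝ) ^ (k * (u + 1 + 1)) = (q:ℝ) ^ (k * u) * (q:ℝ) ^ k * (q:ℝ) ^ k := by ring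
  rw [e1, e2, e3] at hcnt
  rw [e1] at hdis
  rw [e4]
  have hMr : ((q:ℝ) ^ k - 1) * M = (q:ℝ) ^ r * (q:ℝ) ^ (k * u) * (q:ℝ) ^ k - (q:ℝ) ^ r := by
    exact_mod_cast hM
  have hxyr : (q:ℝ) ^ r < (q:ℝ) ^ k := by exact_mod_cast hxy
  have hyr : 1 < (q:ℝ) ^ r := by exact_mod_cast hy
  obtain ⟨s, hs⟩ : ∃ s : ℤ, s = (q:ℤ) ^ k * M + (q:ℤ) ^ r - S.card := ⟨_, rfl⟩
  have hN : (S.card : ℤ) = (q:ℤ) ^ k * M + (q:ℤ) ^ r - s := by linarith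
  have hNr : (S.card : ℝ) = (q:ℝ) ^ k * M + (q:ℝ) ^ r - s := by exact_mod_cast hN
  rw [hN] at hcnt hdis
  rw [hNr]
  generalize (q:ℝ) ^ (k * u) = Zr at *
  have hfin : (q:ℝ) ^ r * (Zr * (q:ℝ) ^ k * (q:ℝ) ^ k - 1) / ((q:ℝ) ^ k - 1)
      = (q:ℝ) ^ k * M + (q:ℝ) ^ r := by
    rw [div_eq_iff (by linarith)]
    linear_combination (-(q:ℝ)^k) * hMr
  rw [hfin]
  have key : 0 < s ^ 2 + (2 * ((q:ℤ) ^ k - (q:ℤ) ^ r) + 1) * s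
      - ((q:ℤ) ^ k - (q:ℤ) ^ r) * ((q:ℤ) ^ r - 1) ∧ 0 ≤ s := by
    clear hN hs e1 e2 e3
    generalize (q:ℤ) ^ k = x at *
    generalize (q:ℤ) ^ r = y at *
    generalize (q:ℤ) ^ (k * u) = Z at *
    have hs0 : 0 ≤ s := by
      by_contra hneg
      have h1 : s + 1 ≤ 0 := by omega
      have h2 : (x * M + y - s) * (x - 1) = y * Z * x * x - y - s * (x - 1) := by
        linear_combination x * hM
      nlinarith
    refine ⟨?_, hs0⟩
    have hmain : s * (s + 1) ≤ y * Z * (s ^ 2 + (2 * (x - y) + 1) * s - (x - y) * (y - 1)) := by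
      have hw : x * M + y - s - M = y * Z * x - s := by linear_combination hM
      rw [hw] at hcnt
      have hid : (x * M + y - s) * (y * Z * x) + (x * M + y - s) * (x * M + y - s - 1) * (y * Z)
          - (2 * M + 1) * ((x * M + y - s) * (y * Z * x)) + M * (M + 1) * (y * Z * x * x)
          = y * Z * ((y - s) ^ 2 - y + s + x * (y * Z * x - y)) := by
        linear_combination (y * Z * x) * hM
      rw [hid] at hcnt
      linarith
    have hyZ : 0 < y * Z := by positivity
    rcases hs0.eq_or_lt with h | h
    · subst h
      exfalso
      have : 0 < (x - y) * (y - 1) := mul_pos (by linarith) (by linarith)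
      nlinarith
    · have : 0 < s * (s + 1) := by positivity
      exact pos_of_mul_pos_right (lt_of_lt_of_le this hmain) hyZ.le
  obtain ⟨hf, hs0⟩ := key
  have hfr : 0 < (s:ℝ) ^ 2 + (2 * ((q:ℝ) ^ k - (q:ℝ) ^ r) + 1) * s
      - ((q:ℝ) ^ k - (q:ℝ) ^ r) * ((q:ℝ) ^ r - 1) := by exact_mod_cast hf
  have hs0r : (0:ℝ) ≤ s := by exact_mod_cast hs0
  have hθs : θ < s := by
    have : Real.sqrt (1 + 4 * (q : ℝ) ^ k * ((q : ℝ) ^ k - (q : ℝ) ^ r))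
        < 2 * s + (2 * (q : ℝ) ^ k - 2 * (q : ℝ) ^ r + 1) := by
      rw [Real.sqrt_lt' (by linarith)]
      nlinarith
    linarith
  have hfl : ⌊θ⌋ + 1 ≤ s := Int.floor_lt.mpr hθs
  have hflr : (⌊θ⌋ : ℝ) + 1 ≤ s := by exact_mod_cast hfl
  linarith
end

section
/- Let q be an odd prime power and let t ≥ 1 and k ≥ 4 be integers. Set p = (q^{kt+2} − q^2)/(q^k − 1) + (q+1)/2 and m = (q^{k(t+1)+2} − q^2)/(q^k − 1) − (q^2 − 1)/2. Then there is no vector space partition of 𝔽_q^{k(t+1)+1} consisting of exactly p − 1 subspaces of dimension k, exactly m − p + 1 subspaces of dimension k − 1, and exactly (q+1)/2 + q^{k−1} subspaces of dimension 1 (and no subspaces of any other dimension). -/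
open Classical in
lemma aux_card {F : Type} [Field F] [Fintype F] {W : Type} [AddCommGroup W] [Module F W]
    [Fintype W] (φ : W →ₗ[F] F) (hφ : φ ≠ 0) :
    Fintype.card W = Fintype.card F ^ Module.finrank F W ∧ 1 ≤ Module.finrank F W ∧
    (Finset.univ.filter (fun w => φ w = 0)).card
      = Fintype.card F ^ (Module.finrank F W - 1) ∧
    (Finset.univ.filter (fun w => φ w ≠ 0)).card
      = (Fintype.card F - 1) * Fintype.card F ^ (Module.finrank F W - 1) := by
  have h1 : Fintype.card W = Fintype.card F ^ Module.finrank F W :=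
    Module.card_eq_pow_finrank
  have h2 := LinearMap.finrank_range_add_finrank_ker φ
  have hs : LinearMap.range φ = ⊤ := LinearMap.range_eq_top.2 (LinearMap.surjective hφ)
  rw [hs, finrank_top, Module.finrank_self] at h2
  have h3 : (Finset.univ.filter (fun w => φ w = 0)).card
      = Fintype.card F ^ (Module.finrank F W - 1) := by
    have : Fintype.card (LinearMap.ker φ) = Fintype.card F ^ Module.finrank F (LinearMap.ker φ) :=
      Module.card_eq_pow_finrank
    rw [show Module.finrank F W - 1 = Module.finrank F (LinearMap.ker φ) by omega, ← this]
    rw [Fintype.card_subtype]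
    simp [LinearMap.mem_ker]
  refine ⟨h1, by omega, h3, ?_⟩
  have h4 := Finset.card_filter_add_card_filter_not (s := (Finset.univ : Finset W))
    (fun w => φ w = 0)
  rw [Finset.card_univ, h1, h3] at h4
  obtain ⟨d, hd⟩ : ∃ d, Module.finrank F W = d + 1 := ⟨Module.finrank F W - 1, by omega⟩
  rw [hd] at h4 ⊢
  simp only [Nat.add_sub_cancel] at h4 ⊢
  rw [Nat.sub_mul, one_mul, mul_comm, ← pow_succ]
  simp only [ne_eq]
  omega

/-- The number of one-dimensional members not killed by `f`. -/
noncomputable def auxN {F V : Type} [Field F] [AddCommGroup V] [Module F V]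
    (S : Finset (Submodule F V)) (f : V →ₗ[F] F) : ℕ :=
  open Classical in (S.filter (fun U => ¬ U ≤ LinearMap.ker f)).card

open Classical in
lemma aux_sub {F V : Type} [Field F] [Fintype F] [AddCommGroup V] [Module F V] [Fintype V]
    (f : V →ₗ[F] F) (U : Submodule F V) :
    (Finset.univ.filter (fun v => v ∈ U ∧ f v ≠ 0)).card =
      if U ≤ LinearMap.ker f then 0 else
        (Fintype.card F - 1) * Fintype.card F ^ (Module.finrank F U - 1) := by
  split_ifs with h
  · rw [Finset.card_eq_zero, Finset.filter_eq_empty_iff]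
    rintro v - ⟨hv, hf⟩
    exact hf (h hv)
  · have hne : f.comp U.subtype ≠ 0 := by
      intro h0
      apply h
      intro v hv
      exact LinearMap.congr_fun h0 ⟨v, hv⟩
    rw [← (aux_card (f.comp U.subtype) hne).2.2.2]
    symm
    apply Finset.card_bij (fun (u : U) _ => (u : V))
    · intro a ha
      exact Finset.mem_filter.2 ⟨Finset.mem_univ _, a.2, (Finset.mem_filter.1 ha).2⟩
    · intro a _ b _ hab
      exact Subtype.ext hab
    · intro b hb
      simp only [Finset.mem_filter, Finset.mem_univ, true_and] at hb
      exact ⟨⟨b, hb.1⟩, Finset.mem_filter.2 ⟨Finset.mem_univ _, hb.2⟩, rfl⟩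

open Classical in
lemma aux_dvd {F V : Type} [Field F] [Fintype F] [AddCommGroup V] [Module F V] [Fintype V]
    (k : ℕ) (hk : 4 ≤ k) (hn : k ≤ Module.finrank F V) (P : Finset (Submodule F V))
    (hP : ∀ v : V, v ≠ 0 → ∃! U, U ∈ P ∧ v ∈ U)
    (hd : ∀ U ∈ P, Module.finrank F U = k ∨
          Module.finrank F U = k - 1 ∨ Module.finrank F U = 1) (f : V →ₗ[F] F) :
    Fintype.card F ^ (k - 2) ∣ auxN (P.filter (fun U => Module.finrank F U = 1)) f := by
  by_cases hf : f = 0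
  · subst hf
    simp [auxN]
  have hq : 1 < Fintype.card F := Fintype.one_lt_card
  have key : (Finset.univ.filter (fun v => f v ≠ 0)).card =
      ∑ U ∈ P, (Finset.univ.filter (fun v => v ∈ U ∧ f v ≠ 0)).card := by
    rw [← Finset.card_biUnion]
    · congr 1
      ext v
      simp only [Finset.mem_filter, Finset.mem_univ, true_and, Finset.mem_biUnion]
      constructor
      · intro hv
        obtain ⟨U, hU, -⟩ := hP v (by rintro rfl; simp at hv)
        exact ⟨U, hU.1, hU.2, hv⟩
      · rintro ⟨U, _, _, h⟩
        exact h
    · intro U hU U' hU' hne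
      rw [Function.onFun, Finset.disjoint_left]
      intro v hv hv'
      simp only [Finset.mem_filter, Finset.mem_univ, true_and] at hv hv'
      have hv0 : v ≠ 0 := by rintro rfl; simp at hv
      exact hne ((hP v hv0).unique ⟨hU, hv.1⟩ ⟨hU', hv'.1⟩)
  rw [(aux_card f hf).2.2.2, ← Finset.sum_filter_add_sum_filter_not P
    (fun U => Module.finrank F U = 1)] at key
  have e1 : ∑ U ∈ P.filter (fun U : Submodule F V => Module.finrank F U = 1),
      (Finset.univ.filter (fun v => v ∈ U ∧ f v ≠ 0)).card =
      (Fintype.card F - 1) * auxN (P.filter (fun U => Module.finrank F U = 1)) f := by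
    rw [auxN, Finset.card_filter, Finset.mul_sum]
    apply Finset.sum_congr rfl
    intro U hU
    rw [aux_sub, (Finset.mem_filter.1 hU).2]
    split_ifs <;> simp
  have e2 : (Fintype.card F - 1) * Fintype.card F ^ (k - 2) ∣
      ∑ U ∈ P.filter (fun U : Submodule F V => ¬ Module.finrank F U = 1),
      (Finset.univ.filter (fun v => v ∈ U ∧ f v ≠ 0)).card := by
    apply Finset.dvd_sum
    intro U hU
    rw [Finset.mem_filter] at hU
    rw [aux_sub]
    split_ifs
    · simp
    · apply Nat.mul_dvd_mul_left
      apply pow_dvd_pow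
      have := hd U hU.1
      omega
  have e3 : (Fintype.card F - 1) * Fintype.card F ^ (k - 2) ∣
      (Fintype.card F - 1) * Fintype.card F ^ (Module.finrank F V - 1) :=
    Nat.mul_dvd_mul_left _ (pow_dvd_pow _ (by omega))
  rw [key, e1] at e3
  exact Nat.dvd_of_mul_dvd_mul_left (by omega) ((Nat.dvd_add_left e2).1 e3)

lemma aux_gen {F V : Type} [Field F] [AddCommGroup V] [Module F V]
    (U : Submodule F V) (hU : Module.finrank F U = 1) :
    ∃ v : V, v ≠ 0 ∧ ∀ f : V →ₗ[F] F, U ≤ LinearMap.ker f ↔ f v = 0 := by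
  obtain ⟨v, hv, hv'⟩ := finrank_eq_one_iff'.1 hU
  refine ⟨v, by simpa using hv, fun f => ⟨fun h => h v.2, fun h w hw => ?_⟩⟩
  obtain ⟨c, hc⟩ := hv' ⟨w, hw⟩
  have : w = c • (v : V) := by
    rw [← Submodule.coe_smul, hc]
  simp [this, h]

open Classical in
lemma aux_dual {F V : Type} [Field F] [Fintype F] [AddCommGroup V] [Module F V] [Fintype V]
    [Fintype (V →ₗ[F] F)] (v : V) (hv : v ≠ 0) :
    Fintype.card (V →ₗ[F] F) = Fintype.card F ^ Module.finrank F V ∧ 1 ≤ Module.finrank F V ∧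
    (Finset.univ.filter (fun f : V →ₗ[F] F => f v = 0)).card
      = Fintype.card F ^ (Module.finrank F V - 1) ∧
    (Finset.univ.filter (fun f : V →ₗ[F] F => f v ≠ 0)).card
      = (Fintype.card F - 1) * Fintype.card F ^ (Module.finrank F V - 1) := by
  have hne : Module.Dual.eval F V v ≠ 0 := by
    intro h
    exact hv ((Module.forall_dual_apply_eq_zero_iff F v).1 (fun f => LinearMap.congr_fun h f))
  have := aux_card (W := V →ₗ[F] F) (Module.Dual.eval F V v) hne
  have hd : Module.finrank F (V →ₗ[F] F) = Module.finrank F V := Subspace.dual_finrank_eq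
  rw [hd] at this
  exact this

open Classical in
lemma aux_main {F V : Type} [Field F] [Fintype F] [AddCommGroup V] [Module F V] [Fintype V]
    (k h : ℕ) (hk : 4 ≤ k) (h0 : 0 < h) (hh : h < Fintype.card F)
    (S : Finset (Submodule F V)) (hS : ∀ U ∈ S, Module.finrank F U = 1)
    (hc : S.card = h + Fintype.card F ^ (k - 1))
    (hdvd : ∀ f, Fintype.card F ^ (k - 2) ∣ auxN S f) : False := by
  have : Finite (V →ₗ[F] F) := Finite.of_injective _ DFunLike.coe_injective
  have : Fintype (V →ₗ[F] F) := Fintype.ofFinite _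
  have hq : 1 < Fintype.card F := Fintype.one_lt_card
  set q := Fintype.card F with hqd
  obtain ⟨j, rfl⟩ : ∃ j, k = j + 4 := ⟨k - 4, by omega⟩
  simp only [show j + 4 - 2 = j + 2 by omega, show j + 4 - 1 = j + 3 by omega] at *
  choose! w hw0 hw using fun U (hU : U ∈ S) => aux_gen U (hS U hU)
  have hN : ∀ f, auxN S f = (S.filter (fun U => f (w U) ≠ 0)).card := by
    intro f
    rw [auxN]
    congr 1
    apply Finset.filter_congr
    intro U hU
    rw [hw U hU]
  obtain ⟨U0, hU0⟩ : S.Nonempty := by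
    rw [← Finset.card_pos]; omega
  obtain ⟨hcard, hn, -, -⟩ := aux_dual (F := F) (w U0) (hw0 U0 hU0)
  obtain ⟨n, hnn⟩ : ∃ n, Module.finrank F V = n + 1 := ⟨Module.finrank F V - 1, by omega⟩
  rw [hnn] at hcard
  have hZ : ∀ U ∈ S, (Finset.univ.filter (fun f : V →ₗ[F] F => f (w U) = 0)).card = q ^ n := by
    intro U hU
    rw [(aux_dual (w U) (hw0 U hU)).2.2.1, hnn]; rfl
  have hNZ : ∀ U ∈ S, (Finset.univ.filter (fun f : V →ₗ[F] F => f (w U) ≠ 0)).card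
      = (q - 1) * q ^ n := by
    intro U hU
    rw [(aux_dual (w U) (hw0 U hU)).2.2.2, hnn]; rfl
  -- first step
  have step1 : ∃ f : V →ₗ[F] F, auxN S f = q ^ (j + 3) := by
    by_contra hcon
    push Not at hcon
    have hle : ∀ f : V →ₗ[F] F, auxN S f ≤ (q - 1) * q ^ (j + 2) := by
      intro f
      obtain ⟨e, he⟩ := hdvd f
      have h1 : auxN S f ≤ S.card := by rw [hN]; exact Finset.card_filter_le _ _
      have h2 := hcon f
      rw [he] at h1 h2 ⊢
      have h3 : e < q + 1 := by
        by_contra h3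
        have : q ^ (j + 2) * (q + 1) ≤ q ^ (j + 2) * e := Nat.mul_le_mul_left _ (by omega)
        have h5 : q ^ (j+2) * (q+1) = q ^ (j+3) + q ^ (j+2) := by ring
        have h6 : q ^ 1 ≤ q ^ (j+2) := Nat.pow_le_pow_right (by omega) (by omega)
        rw [pow_one] at h6
        rw [h5] at this
        omega
      have h4 : e ≠ q := by
        rintro rfl
        apply h2; ring
      rw [mul_comm]
      exact Nat.mul_le_mul_right _ (by omega)
    have hsum : ∑ f : V →ₗ[F] F, auxN S f = S.card * ((q - 1) * q ^ n) := by
      simp_rw [hN, Finset.card_filter]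
      rw [Finset.sum_comm, ← smul_eq_mul, ← Finset.sum_const]
      apply Finset.sum_congr rfl
      intro U hU
      rw [← hNZ U hU, Finset.card_filter]
    have hsum2 : ∑ f : V →ₗ[F] F, auxN S f ≤ q ^ (n + 1) * ((q - 1) * q ^ (j + 2)) := by
      rw [← hcard, ← Finset.card_univ, ← smul_eq_mul, ← Finset.sum_const]
      exact Finset.sum_le_sum (fun f _ => hle f)
    rw [hsum, hc] at hsum2
    have h1 : q ^ (n + 1) * ((q - 1) * q ^ (j + 2)) = q ^ (j+3) * ((q-1) * q ^ n) := by ring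
    rw [h1, add_mul] at hsum2
    have : 0 < h * ((q - 1) * q ^ n) := by
      have : 0 < q - 1 := by omega
      positivity
    omega
  obtain ⟨f, hf⟩ := step1
  have hZc : (S.filter (fun U => f (w U) = 0)).card = h := by
    have := Finset.card_filter_add_card_filter_not (s := S) (fun U => f (w U) = 0)
    rw [hN] at hf
    simp only [ne_eq] at hf
    omega
  obtain ⟨g, hg⟩ : ∃ g : V →ₗ[F] F, ∀ U ∈ S, f (w U) = 0 → g (w U) ≠ 0 := by
    by_contra hcon
    push Not at hcon
    have hu : (Finset.univ : Finset (V →ₗ[F] F)) ⊆ (S.filter (fun U => f (w U) = 0)).biUnion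
        (fun U => Finset.univ.filter (fun g : V →ₗ[F] F => g (w U) = 0)) := by
      intro g _
      obtain ⟨U, hU, h1, h2⟩ := hcon g
      simp only [Finset.mem_biUnion, Finset.mem_filter, Finset.mem_univ, true_and]
      exact ⟨U, ⟨hU, h1⟩, h2⟩
    have h1 := (Finset.card_le_card hu).trans (Finset.card_biUnion_le_card_mul _ _ (q ^ n)
      (fun U hU => (hZ U (Finset.mem_filter.1 hU).1).le))
    rw [hZc, Finset.card_univ, hcard, pow_succ, mul_comm] at h1
    have := Nat.le_of_mul_le_mul_right h1 (by positivity)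
    omega
  have hsum : ∑ a : F, auxN S (g + a • f) = h * q + q ^ (j + 3) * (q - 1) := by
    simp_rw [hN, Finset.card_filter]
    rw [Finset.sum_comm, ← Finset.sum_filter_add_sum_filter_not S (fun U => f (w U) = 0)]
    congr 1
    · rw [← hZc, ← smul_eq_mul, ← Finset.sum_const]
      apply Finset.sum_congr rfl
      intro U hU
      rw [Finset.mem_filter] at hU
      simp [hU.2, hg U hU.1 hU.2, hqd]
    · rw [← hf, hN, ← smul_eq_mul, ← Finset.sum_const]
      apply Finset.sum_congr rfl
      intro U hU
      rw [Finset.mem_filter] at hU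
      rw [← Finset.card_filter]
      have : (Finset.univ.filter (fun a : F => (g + a • f) (w U) ≠ 0))
          = Finset.univ.erase (- g (w U) / f (w U)) := by
        ext a
        have h3 := hU.2
        simp only [Finset.mem_filter, Finset.mem_univ, true_and, Finset.mem_erase, and_true,
          LinearMap.add_apply, LinearMap.smul_apply, smul_eq_mul]
        rw [not_iff_not, eq_div_iff h3]
        constructor
        · intro h; linear_combination h
        · intro h; linear_combination h
      rw [this, Finset.card_erase_of_mem (Finset.mem_univ _), Finset.card_univ]
  have hdv : q ^ (j + 2) ∣ h * q + q ^ (j + 3) * (q - 1) := by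
    rw [← hsum]
    exact Finset.dvd_sum (fun a _ => hdvd _)
  have hdv2 : q ^ (j + 2) ∣ h * q :=
    (Nat.dvd_add_left (Dvd.dvd.mul_right (pow_dvd_pow q (by omega)) _)).1 hdv
  have hdv3 : q * q ∣ h * q := by
    rw [← pow_two]
    exact (pow_dvd_pow q (by omega)).trans hdv2
  have := Nat.le_of_dvd h0 (Nat.dvd_of_mul_dvd_mul_right (by omega) hdv3)
  omega

/-- Lemma: for odd prime powers `q`, integers `t ≥ 1`, `k ≥ 4`, and
`p = (q^{kt+2} − q^2)/(q^k − 1) + (q+1)/2`,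
`m = (q^{k(t+1)+2} − q^2)/(q^k − 1) − (q^2 − 1)/2`, there is no vector space
partition of `𝔽_q^{k(t+1)+1}` of type
`k^{p−1} (k−1)^{m−p+1} 1^{(q+1)/2 + q^{k−1}}`. -/
theorem no_partition_type_odd_q (F : Type) [Field F] [Fintype F]
    (q t k p m : ℕ) (hq : Fintype.card F = q) (hodd : Odd q)
    (ht : 1 ≤ t) (hk : 4 ≤ k)
    (hp : p = (q ^ (k * t + 2) - q ^ 2) / (q ^ k - 1) + (q + 1) / 2)
    (hm : m = (q ^ (k * (t + 1) + 2) - q ^ 2) / (q ^ k - 1) - (q ^ 2 - 1) / 2) :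
    ¬ ∃ P : Finset (Submodule F (Fin (k * (t + 1) + 1) → F)),
        (⊥ ∉ P) ∧
        (∀ v : Fin (k * (t + 1) + 1) → F, v ≠ 0 → ∃! U, U ∈ P ∧ v ∈ U) ∧
        (∀ U ∈ P, Module.finrank F U = k ∨
          Module.finrank F U = k - 1 ∨ Module.finrank F U = 1) ∧
        (P.filter (fun (U : Submodule F (Fin (k * (t + 1) + 1) → F)) =>
          Module.finrank F ↥U = k)).card = p - 1 ∧
        (P.filter (fun (U : Submodule F (Fin (k * (t + 1) + 1) → F)) =>
          Module.finrank F ↥U = k - 1)).card = m - p + 1 ∧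
        (P.filter (fun (U : Submodule F (Fin (k * (t + 1) + 1) → F)) =>
          Module.finrank F ↥U = 1)).card = (q + 1) / 2 + q ^ (k - 1) := by
  classical
  rintro ⟨P, -, hP, hd, -, -, h1⟩
  have hq1 : 1 < Fintype.card F := Fintype.one_lt_card
  refine aux_main (F := F) k ((q + 1) / 2) hk (by omega) (by omega)
    (P.filter (fun U => Module.finrank F U = 1)) (fun U hU => (Finset.mem_filter.1 hU).2)
    ?_ (aux_dvd k hk ?_ P hP hd)
  · rw [hq, ← h1]
  · rw [Module.finrank_fin_fun]
    nlinarith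
end
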